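/- Let R be a *-ring, B an (R,R)-bimodule, and D : R → B a derivation. Let u ∈ R be a unitary (u*·u = u·u* = 1) and let h ∈ R be such that D(h) = 0 and D(u·h·u*) = 0. If the only element ξ ∈ B satisfying h·ξ = ξ·h is ξ = 0, then D(u) = 0. -/

import Mathlib

open MulOpposite in
/-- Key lemma of the paper: if a derivation `D` from a `*`-ring `R` into an
`(R,R)`-bimodule `B` satisfies `D h = 0` and `D (u * h * u*) = 0` for a unitary `u`,
and the only `ξ ∈ B` commuting with `h` (i.e. `h • ξ = ξ • h`) is `0`,
then `D u = 0`. -/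
theorem derivation_vanishes_on_normalizing_unitary {R B : Type*} [Ring R] [StarRing R]
    [AddCommGroup B] [Module R B] [Module Rᵐᵒᵖ B] [SMulCommClass R Rᵐᵒᵖ B]
    (D : R → B)
    (hadd : ∀ x y : R, D (x + y) = D x + D y)
    (hleib : ∀ x y : R, D (x * y) = x • D y + op y • D x)
    (u h : R) (hu1 : star u * u = 1) (hu2 : u * star u = 1)
    (hDh : D h = 0) (hDuhu : D (u * h * star u) = 0)
    (hreg : ∀ ξ : B, h • ξ = op h • ξ → ξ = 0) :
    D u = 0 := by
  have e : u * h * star u * u = u * h := by rw [mul_assoc, hu1, mul_one]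
  have h1 := hleib (u * h * star u) u
  rw [e, hleib u h, hDh, hDuhu, smul_zero, smul_zero, zero_add, add_zero] at h1
  have h2 : star u • D u = 0 := by
    apply hreg
    rw [← smul_comm (star u) (op h) (D u), h1, smul_smul, smul_smul, mul_assoc u,
      ← mul_assoc (star u), hu1, one_mul]
  rw [← one_smul R (D u), ← hu2, mul_smul, h2, smul_zero]
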